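/- For all a, b, c > 0 and 1 < d < 2 with 2c/d ≥ 3a + b and 2·(c/d − a)·(c/d + 1/2 − a) ≥ a + b, the random variable X_{a,b,c,d} exists. In particular, if additionally a + b ≥ 1, then X_{a,b,c,d} exists whenever 1 < d < 2 and 2c/d ≥ 3a + b. -/

import Mathlib

open MeasureTheory Real

/-- `μ` is a law of the random variable `X_{a,b,c,d}`: a probability measure on `(0,∞)`
whose fractional moments are `Γ(c)/(Γ(a)Γ(b)) · Γ(a+s)Γ(b−s)/Γ(c+d·s)` for `s ∈ (−a,b)`. -/
def IsXLaw (a b c d : ℝ) (μ : Measure ℝ) : Prop :=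
  IsProbabilityMeasure μ ∧ μ (Set.Ioi (0 : ℝ))ᶜ = 0 ∧
    ∀ s ∈ Set.Ioo (-a) b,
      ∫⁻ x, ENNReal.ofReal (x ^ s) ∂μ =
        ENNReal.ofReal (Real.Gamma c / (Real.Gamma a * Real.Gamma b) *
          (Real.Gamma (a + s) * Real.Gamma (b - s) / Real.Gamma (c + d * s)))

/-- The random variable `X_{a,b,c,d}` exists. -/
def XExists (a b c d : ℝ) : Prop :=
  ∃ μ : Measure ℝ, IsXLaw a b c d μ

/-- The rising factorial `x (x + 1) ⋯ (x + n - 1)`. -/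
def risingFactorial (x : ℝ) : ℕ → ℝ
  | 0 => 1
  | n + 1 => risingFactorial x n * (x + n)

theorem risingFactorial_zero (x : ℝ) : risingFactorial x 0 = 1 := rfl

theorem risingFactorial_succ (x : ℝ) (n : ℕ) :
    risingFactorial x (n + 1) = risingFactorial x n * (x + n) := rfl

theorem risingFactorial_pos {x : ℝ} (hx : 0 < x) (n : ℕ) : 0 < risingFactorial x n := by
  induction n with
  | zero => simp [risingFactorial_zero]
  | succ n ih => rw [risingFactorial_succ]; positivity

theorem risingFactorial_add (x : ℝ) (n k : ℕ) :
    risingFactorial x (n + k) = risingFactorial x n * risingFactorial (x + n) k := by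
  induction k with
  | zero => simp [risingFactorial_zero]
  | succ k ih =>
    rw [← add_assoc, risingFactorial_succ, ih, risingFactorial_succ]; push_cast; ring

theorem risingFactorial_two_mul (x : ℝ) (k : ℕ) :
    risingFactorial x (2 * k) =
      4 ^ k * risingFactorial (x / 2) k * risingFactorial (x / 2 + 1 / 2) k := by
  induction k with
  | zero => simp [risingFactorial_zero]
  | succ k ih =>
    rw [show 2 * (k + 1) = 2 * k + 1 + 1 by ring, risingFactorial_succ, risingFactorial_succ, ih,
      risingFactorial_succ, risingFactorial_succ]
    push_cast; ring

theorem risingFactorial_le {x y : ℝ} (hx : 0 < x) (hxy : x ≤ y) (n : ℕ) :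
    risingFactorial x n ≤ risingFactorial y n := by
  induction n with
  | zero => simp [risingFactorial_zero]
  | succ n ih =>
    rw [risingFactorial_succ, risingFactorial_succ]
    have h1 := (risingFactorial_pos (hx.trans_le hxy) n).le
    gcongr

theorem pow_le_risingFactorial {x : ℝ} (hx : 0 < x) (n : ℕ) : x ^ n ≤ risingFactorial x n := by
  induction n with
  | zero => simp [risingFactorial_zero]
  | succ n ih =>
    rw [risingFactorial_succ, pow_succ]
    have hn : (0 : ℝ) ≤ n := n.cast_nonneg
    exact mul_le_mul ih (by linarith) hx.le (risingFactorial_pos hx n).le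

theorem Gamma_add_natCast {x : ℝ} (hx : 0 < x) (n : ℕ) :
    Gamma (x + n) = risingFactorial x n * Gamma x := by
  induction n with
  | zero => simp [risingFactorial_zero]
  | succ n ih =>
    rw [risingFactorial_succ, Nat.cast_succ, ← add_assoc, Gamma_add_one (by positivity), ih]; ring

theorem risingFactorial_eq_ascPochhammer (x : ℝ) (n : ℕ) :
    risingFactorial x n = (ascPochhammer ℝ n).eval x := by
  induction n with
  | zero => simp [risingFactorial_zero]
  | succ n ih => rw [risingFactorial_succ, ascPochhammer_succ_eval, ih]

theorem ringChoose_eq_risingFactorial_div (x : ℝ) (n : ℕ) :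
    Ring.choose (x + n - 1) n = risingFactorial x n / n.factorial := by
  have h := Ring.factorial_nsmul_multichoose_eq_ascPochhammer x n
  rw [Ring.multichoose_eq, Polynomial.ascPochhammer_smeval_eq_eval,
    ← risingFactorial_eq_ascPochhammer, nsmul_eq_mul] at h
  rw [← h]
  field_simp

/-- Coefficients of the square of the Bessel-type series `∑ Xⁱ / (i! (ρ)ᵢ)`. -/
theorem sum_antidiagonal_inv_risingFactorial {ρ : ℝ} (hρ : 0 < ρ) (j : ℕ) :
    ∑ p ∈ Finset.HasAntidiagonal.antidiagonal j,
        1 / (p.1.factorial * risingFactorial ρ p.1) * (1 / (p.2.factorial * risingFactorial ρ p.2)) =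
      risingFactorial (2 * ρ + j - 1) j / (j.factorial * risingFactorial ρ j ^ 2) := by
  have h := Ring.add_choose_eq (r := ρ + j - 1) (s := ρ + j - 1) j (Commute.all _ _)
  rw [show ρ + j - 1 + (ρ + j - 1) = (2 * ρ + j - 1) + j - 1 by ring,
    ringChoose_eq_risingFactorial_div] at h
  have hj := (risingFactorial_pos hρ j).ne'
  rw [← div_div, h, Finset.sum_div]
  refine Finset.sum_congr rfl fun p hp => ?_
  obtain ⟨i, l⟩ := p
  rw [Finset.HasAntidiagonal.mem_antidiagonal] at hp
  dsimp only at hp ⊢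
  have hi : Ring.choose (ρ + j - 1) i = risingFactorial (ρ + l) i / i.factorial := by
    rw [← ringChoose_eq_risingFactorial_div]; congr 1; rw [← hp]; push_cast; ring
  have hl : Ring.choose (ρ + j - 1) l = risingFactorial (ρ + i) l / l.factorial := by
    rw [← ringChoose_eq_risingFactorial_div]; congr 1; rw [← hp]; push_cast; ring
  rw [hi, hl]
  have e1 : risingFactorial ρ j = risingFactorial ρ l * risingFactorial (ρ + l) i := by
    rw [← risingFactorial_add, add_comm, hp]
  have e2 : risingFactorial ρ j = risingFactorial ρ i * risingFactorial (ρ + i) l := by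
    rw [← risingFactorial_add, hp]
  have h1 := (risingFactorial_pos hρ l).ne'
  have h2 := (risingFactorial_pos hρ i).ne'
  have h3 := (risingFactorial_pos (show 0 < ρ + l by positivity) i).ne'
  have h4 := (risingFactorial_pos (show 0 < ρ + i by positivity) l).ne'
  rw [sq]
  nth_rw 1 [e1]
  rw [e2]
  field_simp

/-- The pair of sequences `(Θₙ, Eₙ)` whose first component gives the weights of the squares in
the sum-of-squares expansion; here `m = 2 A + μ` and `B = A + μ`. -/
noncomputable def squareWeight (A μ : ℝ) : ℕ → ℝ × ℝ
  | 0 => (1, 2 * (μ - A))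
  | n + 1 =>
    let θ := ((squareWeight A μ n).2 +
        (2 * n + μ - 1) * (2 * n + μ) * (squareWeight A μ n).1) /
      ((2 * n + (2 * A + μ)) * (2 * n + (2 * A + μ) + 1))
    (θ, ((n + 1) * (squareWeight A μ n).2 + 2 * (μ - A) * (2 * n + (A + μ) + 1) * θ) /
      (n + (A + μ)))

theorem squareWeight_succ_fst (A μ : ℝ) (n : ℕ) : (squareWeight A μ (n + 1)).1 =
    ((squareWeight A μ n).2 + (2 * n + μ - 1) * (2 * n + μ) * (squareWeight A μ n).1) /
      ((2 * n + (2 * A + μ)) * (2 * n + (2 * A + μ) + 1)) := rfl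

theorem squareWeight_succ_snd (A μ : ℝ) (n : ℕ) : (squareWeight A μ (n + 1)).2 =
    ((n + 1) * (squareWeight A μ n).2 +
      2 * (μ - A) * (2 * n + (A + μ) + 1) * (squareWeight A μ (n + 1)).1) / (n + (A + μ)) := rfl

theorem squareWeight_one_nonneg {A μ : ℝ} (hA : 0 < A) (h1 : A ≤ μ) (h2 : 2 * A ≤ μ * (μ + 1)) :
    0 ≤ (squareWeight A μ 1).1 ∧ 0 ≤ (squareWeight A μ 1).2 := by
  have hμ : 0 < μ := hA.trans_le h1
  have h : 0 ≤ (squareWeight A μ (0 + 1)).1 := by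
    rw [squareWeight_succ_fst]
    simp only [squareWeight]
    apply div_nonneg _ (by positivity)
    push_cast
    nlinarith
  refine ⟨h, ?_⟩
  rw [← zero_add 1, squareWeight_succ_snd]
  have : 0 ≤ μ - A := by linarith
  have h0 : (squareWeight A μ 0).2 = 2 * (μ - A) := rfl
  rw [h0]
  positivity

theorem squareWeight_nonneg {A μ : ℝ} (hA : 0 < A) (h1 : A ≤ μ) (h2 : 2 * A ≤ μ * (μ + 1))
    (n : ℕ) : 0 ≤ (squareWeight A μ n).1 ∧ 0 ≤ (squareWeight A μ n).2 := by
  have hμ : 0 < μ := hA.trans_le h1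
  have h3 : 0 ≤ μ - A := by linarith
  match n with
  | 0 => exact ⟨zero_le_one, by show 0 ≤ 2 * (μ - A); positivity⟩
  | 1 => exact squareWeight_one_nonneg hA h1 h2
  | n + 2 =>
    obtain ⟨i1, i2⟩ := squareWeight_nonneg hA h1 h2 (n + 1)
    have h : 0 ≤ (squareWeight A μ (n + 1 + 1)).1 := by
      rw [squareWeight_succ_fst]
      have : 0 ≤ 2 * ((n + 1 : ℕ) : ℝ) + μ - 1 := by
        push_cast; have : (0 : ℝ) ≤ n := n.cast_nonneg
        linarith
      positivity
    refine ⟨h, ?_⟩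
    rw [squareWeight_succ_snd]
    positivity

/-- The numerators `V₀ = 1`, `Vₙ₊₁ = (B)ₙ (2 n + 1 + B)`. -/
noncomputable def squareNumer (B : ℝ) : ℕ → ℝ
  | 0 => 1
  | n + 1 => risingFactorial B n * (2 * n + 1 + B)

/-- The summands of the finite sum that gives the coefficients of the sum of squares. -/
noncomputable def squareSummand (A μ : ℝ) (k n : ℕ) : ℝ :=
  (-1) ^ n * k.choose n * squareNumer (A + μ) n * (squareWeight A μ n).1 /
    risingFactorial (A + μ) (n + k)

theorem cast_choose_succ_mul (k n : ℕ) :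
    (k.choose (n + 1) : ℝ) * (n + 1) = k.choose n * (k - n) := by
  rcases le_or_gt n k with h | h
  · rw [← Nat.cast_sub h]; exact_mod_cast Nat.choose_succ_right_eq k n
  · simp [Nat.choose_eq_zero_of_lt h, Nat.choose_eq_zero_of_lt (h.trans (Nat.lt_succ_self n))]

theorem sum_squareSummand_aux {A μ : ℝ} (hA : 0 < A) (hμ : 0 < μ) (k N : ℕ) :
    ∑ n ∈ Finset.range (N + 1), ((A + k) * ((A + μ - 1) / 2 + 1 + k) * squareSummand A μ k n -
        ((A + μ) / 2 + k) * ((2 * A + μ) / 2 + k) * ((2 * A + μ) / 2 + 1 / 2 + k) *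
          squareSummand A μ (k + 1) n) =
      -(1 / 8) * (-1) ^ N * risingFactorial (A + μ) N * k.choose N /
          risingFactorial (A + μ) (N + k + 1) *
        ((A + μ + 2 * k) * ((2 * N + (2 * A + μ)) * (2 * N + (2 * A + μ) + 1) *
          (squareWeight A μ (N + 1)).1) - (k - N) * (squareWeight A μ N).2) := by
  have hB : 0 < A + μ := by positivity
  have hθ : ∀ n : ℕ, (2 * n + (2 * A + μ)) * (2 * n + (2 * A + μ) + 1) *
      (squareWeight A μ (n + 1)).1 = (squareWeight A μ n).2 +
        (2 * n + μ - 1) * (2 * n + μ) * (squareWeight A μ n).1 := by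
    intro n
    rw [squareWeight_succ_fst]; field_simp
  induction N with
  | zero =>
    rw [Finset.sum_range_one, hθ]
    simp only [squareSummand, squareNumer, squareWeight, zero_add, risingFactorial_succ,
      risingFactorial_zero, Nat.choose_zero_right]
    have h1 := (risingFactorial_pos hB k).ne'
    have h2 : (A + μ + k) ≠ 0 := by positivity
    push_cast
    field_simp
    ring
  | succ M ih =>
    rw [Finset.sum_range_succ, ih, hθ (M + 1)]
    have hE : (squareWeight A μ (M + 1)).2 * (M + (A + μ)) = (M + 1) * (squareWeight A μ M).2 +
        2 * (μ - A) * (2 * M + (A + μ) + 1) * (squareWeight A μ (M + 1)).1 := by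
      rw [squareWeight_succ_snd]; field_simp
    have hc := cast_choose_succ_mul k M
    simp only [squareSummand, squareNumer]
    rw [show M + 1 + k = M + k + 1 by ring, show M + 1 + (k + 1) = M + k + 1 + 1 by ring,
      risingFactorial_succ _ (M + k + 1), risingFactorial_succ _ M, Nat.choose_succ_succ]
    have h1 := (risingFactorial_pos hB (M + k + 1)).ne'
    have h2 : (A + μ + (M + k + 1 : ℕ)) ≠ 0 := by positivity
    generalize (squareWeight A μ (M + 1)).1 = θ at *
    generalize (squareWeight A μ (M + 1)).2 = E' at *
    generalize (squareWeight A μ M).2 = E at *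
    generalize risingFactorial (A + μ) (M + k + 1) = D at *
    generalize risingFactorial (A + μ) M = b at *
    push_cast at *
    generalize (k.choose (M + 1) : ℝ) = c at *
    generalize (k.choose M : ℝ) = c₀ at *
    generalize (M : ℝ) = x at *
    generalize (k : ℝ) = z at *
    rw [pow_succ]
    generalize (-1 : ℝ) ^ M = σ at *
    have key : -c₀ * (A + μ + (x + z + 1)) * ((A + μ + 2 * z) * ((2 * x + (2 * A + μ)) *
          (2 * x + (2 * A + μ) + 1) * θ) - (z - x) * E) -
        8 * (2 * x + 1 + (A + μ)) * θ * ((A + z) * ((A + μ - 1) / 2 + 1 + z) * c *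
          (A + μ + (x + z + 1)) - 1 / 8 * (A + μ + 2 * z) * (2 * A + μ + 2 * z) *
          (2 * A + μ + 1 + 2 * z) * (c₀ + c)) +
        (A + μ + x) * c * ((A + μ + 2 * z) * (E' + (2 * (x + 1) + μ - 1) * (2 * (x + 1) + μ) * θ) -
          (z - (x + 1)) * E') * (-1) = 0 := by
      linear_combination (-c * (A + μ + z + x + 1)) * hE + (θ * (A + μ + 2 * z) *
        ((2 * x + (2 * A + μ)) * (2 * x + (2 * A + μ) + 1) -
          (2 * x + 1 + (A + μ)) * (4 * (z + x) + 4 * (2 * A + μ) + 2)) -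
        (A + μ + (x + z + 1)) * E) * hc
    rw [← sub_eq_zero]
    trans σ * b / (8 * D * (A + μ + (x + z + 1))) * 0
    · rw [← key]; field_simp; ring
    · ring

theorem sum_squareSummand_succ {A μ : ℝ} (hA : 0 < A) (hμ : 0 < μ) (k : ℕ) :
    (A + k) * ((A + μ - 1) / 2 + 1 + k) * ∑ n ∈ Finset.range (k + 1), squareSummand A μ k n =
      ((A + μ) / 2 + k) * ((2 * A + μ) / 2 + k) * ((2 * A + μ) / 2 + 1 / 2 + k) *
        ∑ n ∈ Finset.range (k + 1 + 1), squareSummand A μ (k + 1) n := by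
  have h := sum_squareSummand_aux hA hμ k (k + 1)
  have h0 : squareSummand A μ k (k + 1) = 0 := by simp [squareSummand]
  rw [Nat.choose_succ_self, Finset.sum_sub_distrib, ← Finset.mul_sum, ← Finset.mul_sum,
    Finset.sum_range_succ _ (k + 1), h0, add_zero] at h
  simp only [Nat.cast_zero, mul_zero, zero_div, zero_mul] at h
  exact sub_eq_zero.mp h

theorem sum_squareSummand {A μ : ℝ} (hA : 0 < A) (hμ : 0 < μ) (k : ℕ) :
    ∑ n ∈ Finset.range (k + 1), squareSummand A μ k n =
      risingFactorial A k * risingFactorial ((A + μ - 1) / 2 + 1) k /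
        (risingFactorial ((A + μ) / 2) k * risingFactorial ((2 * A + μ) / 2) k *
          risingFactorial ((2 * A + μ) / 2 + 1 / 2) k) := by
  induction k with
  | zero => simp [squareSummand, squareNumer, squareWeight, risingFactorial_zero]
  | succ k ih =>
    have h := sum_squareSummand_succ hA hμ k
    rw [ih] at h
    simp only [risingFactorial_succ]
    have h1 := (risingFactorial_pos (show 0 < (A + μ) / 2 by positivity) k).ne'
    have h2 := (risingFactorial_pos (show 0 < (2 * A + μ) / 2 by positivity) k).ne'
    have h3 := (risingFactorial_pos (show 0 < (2 * A + μ) / 2 + 1 / 2 by positivity) k).ne'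
    generalize risingFactorial ((A + μ) / 2) k = r₁ at *
    generalize risingFactorial ((2 * A + μ) / 2) k = r₂ at *
    generalize risingFactorial ((2 * A + μ) / 2 + 1 / 2) k = r₃ at *
    rw [eq_div_iff (by positivity), ← mul_div_assoc, div_eq_iff (by positivity)] at *
    linear_combination -h

theorem exists_squareWeight_le {A μ : ℝ} (hA : 0 < A) (h1 : A ≤ μ) (h2 : 2 * A ≤ μ * (μ + 1)) :
    ∃ C K : ℝ, 0 ≤ C ∧ 0 ≤ K ∧ ∀ n, (squareWeight A μ n).1 ≤ C * K ^ n := by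
  have hμ : 0 < μ := hA.trans_le h1
  have h3 : 0 ≤ μ - A := by linarith
  set c₁ := 1 + 1 / (A + μ) with hc₁
  set c₂ := 1 / ((2 * A + μ) * (2 * A + μ + 1)) with hc₂
  set c₃ := 2 * (μ - A) * (2 + 1 / (A + μ)) with hc₃
  have p1 : 0 ≤ c₁ := by positivity
  have p2 : 0 ≤ c₂ := by positivity
  have p3 : 0 ≤ c₃ := by positivity
  refine ⟨1 + 2 * (μ - A), c₁ + (1 + c₃) * (1 + c₂), by positivity, by positivity, fun n => ?_⟩
  suffices h : (squareWeight A μ n).1 + (squareWeight A μ n).2 ≤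
      (1 + 2 * (μ - A)) * (c₁ + (1 + c₃) * (1 + c₂)) ^ n by
    linarith [(squareWeight_nonneg hA h1 h2 n).2]
  induction n with
  | zero => simp [squareWeight]
  | succ n ih =>
    obtain ⟨q1, q2⟩ := squareWeight_nonneg hA h1 h2 n
    obtain ⟨q3, q4⟩ := squareWeight_nonneg hA h1 h2 (n + 1)
    have hn : (0 : ℝ) ≤ n := n.cast_nonneg
    have b1 : (squareWeight A μ (n + 1)).1 ≤
        c₂ * (squareWeight A μ n).2 + (squareWeight A μ n).1 := by
      rw [squareWeight_succ_fst, add_div]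
      refine add_le_add ?_ ?_
      · rw [hc₂, one_div_mul_eq_div]
        refine div_le_div_of_nonneg_left q2 (by positivity) ?_
        apply mul_le_mul <;> first | positivity | linarith
      · rw [div_le_iff₀ (by positivity), mul_comm (squareWeight A μ n).1]
        gcongr ?_ * _
        nlinarith [mul_nonneg hn hA.le, mul_nonneg hA.le hμ.le, sq_nonneg A]
    have b2 : (squareWeight A μ (n + 1)).2 ≤
        c₁ * (squareWeight A μ n).2 + c₃ * (squareWeight A μ (n + 1)).1 := by
      rw [squareWeight_succ_snd, div_le_iff₀ (by positivity),
        add_mul (c₁ * _)]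
      refine add_le_add ?_ ?_
      · rw [mul_right_comm]
        gcongr ?_ * _
        rw [hc₁]; field_simp; nlinarith
      · rw [mul_right_comm c₃]
        refine mul_le_mul_of_nonneg_right ?_ q3
        rw [hc₃, mul_assoc (2 * (μ - A))]
        gcongr _ * ?_
        field_simp; nlinarith
    calc _ ≤ c₁ * (squareWeight A μ n).2 + (1 + c₃) * (c₂ * (squareWeight A μ n).2 +
              (squareWeight A μ n).1) := by
            linarith [mul_le_mul_of_nonneg_left b1 (show 0 ≤ 1 + c₃ by positivity)]
      _ ≤ (c₁ + (1 + c₃) * (1 + c₂)) *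
            ((squareWeight A μ n).1 + (squareWeight A μ n).2) := by
            have r1 := mul_nonneg p1 q1
            have r2 := mul_nonneg (show 0 ≤ 1 + c₃ by positivity) (mul_nonneg p2 q1)
            have r3 := mul_nonneg (show 0 ≤ 1 + c₃ by positivity) q2
            linarith
      _ ≤ _ := by
            rw [pow_succ]
            calc _ ≤ (c₁ + (1 + c₃) * (1 + c₂)) * _ := mul_le_mul_of_nonneg_left ih (by positivity)
              _ = _ := by ring

theorem risingFactorial_two_mul_le {x : ℝ} (hx : 0 < x) (n : ℕ) :
    risingFactorial (2 * x) n ≤ 2 ^ n * risingFactorial x n := by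
  induction n with
  | zero => simp [risingFactorial_zero]
  | succ n ih =>
    rw [risingFactorial_succ, risingFactorial_succ]
    have hn : (0 : ℝ) ≤ n := n.cast_nonneg
    have := risingFactorial_pos hx n
    calc _ ≤ (2 ^ n * risingFactorial x n) * (2 * (x + n)) :=
          mul_le_mul ih (by linarith) (by positivity) (by positivity)
      _ = _ := by ring

theorem squareNumer_nonneg {B : ℝ} (hB : 0 < B) (n : ℕ) : 0 ≤ squareNumer B n := by
  cases n with
  | zero => exact zero_le_one
  | succ n =>
    have := risingFactorial_pos hB n
    simp only [squareNumer]; positivity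

theorem squareNumer_le {B : ℝ} (hB : 0 < B) (n : ℕ) :
    squareNumer B n ≤ 2 * 2 ^ n * risingFactorial ((B - 1) / 2 + 1) n := by
  have h : squareNumer B n ≤ 2 * risingFactorial (B + 1) n := by
    cases n with
    | zero => simp [squareNumer, risingFactorial_zero]
    | succ n =>
      rw [squareNumer, risingFactorial_succ]
      have h1 := risingFactorial_le hB (show B ≤ B + 1 by linarith) n
      have h2 := risingFactorial_pos (show 0 < B + 1 by linarith) n
      have hn : (0 : ℝ) ≤ n := n.cast_nonneg
      calc _ ≤ risingFactorial (B + 1) n * (2 * (B + 1 + n)) :=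
            mul_le_mul h1 (by linarith) (by positivity) h2.le
        _ = _ := by ring
  have h1 := risingFactorial_two_mul_le (show 0 < (B - 1) / 2 + 1 by linarith) n
  rw [show 2 * ((B - 1) / 2 + 1) = B + 1 by ring] at h1
  linarith

/-- The coefficients of the squares in the sum-of-squares expansion. -/
noncomputable def squareCoeff (A μ : ℝ) (n : ℕ) : ℝ :=
  squareNumer (A + μ) n * (squareWeight A μ n).1 /
    (n.factorial * risingFactorial ((A + μ - 1) / 2 + 1) n ^ 2)

theorem squareCoeff_nonneg {A μ : ℝ} (hA : 0 < A) (h1 : A ≤ μ) (h2 : 2 * A ≤ μ * (μ + 1))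
    (n : ℕ) : 0 ≤ squareCoeff A μ n :=
  div_nonneg (mul_nonneg (squareNumer_nonneg (by linarith) n) (squareWeight_nonneg hA h1 h2 n).1)
    (by positivity)

theorem summable_squareCoeff {A μ : ℝ} (hA : 0 < A) (h1 : A ≤ μ) (h2 : 2 * A ≤ μ * (μ + 1))
    {X : ℝ} (hX : 0 ≤ X) : Summable fun n => squareCoeff A μ n * X ^ n := by
  obtain ⟨C, K, hC, hK, h⟩ := exists_squareWeight_le hA h1 h2
  have hκ : 0 < (A + μ - 1) / 2 + 1 := by linarith
  refine Summable.of_nonneg_of_le (fun n => mul_nonneg (squareCoeff_nonneg hA h1 h2 n) (by positivity))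
    (fun n => ?_) ((Real.summable_pow_div_factorial
      (2 * K * X / ((A + μ - 1) / 2 + 1))).mul_left (2 * C))
  have hV := squareNumer_le (show 0 < A + μ by linarith) n
  have hV0 := squareNumer_nonneg (show 0 < A + μ by linarith) n
  have hr := pow_le_risingFactorial hκ n
  have hr0 := risingFactorial_pos hκ n
  have hp := pow_pos hκ n
  rw [squareCoeff]
  generalize (A + μ - 1) / 2 + 1 = κ at *
  calc _ ≤ (2 * 2 ^ n * risingFactorial κ n) * (C * K ^ n) /
        (n.factorial * risingFactorial κ n ^ 2) * X ^ n := by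
          gcongr
          · exact (squareWeight_nonneg hA h1 h2 n).1
          · exact h n
    _ = 2 * 2 ^ n * (C * K ^ n) / n.factorial / risingFactorial κ n * X ^ n := by
          field_simp
    _ ≤ 2 * 2 ^ n * (C * K ^ n) / n.factorial / κ ^ n * X ^ n := by gcongr
    _ = _ := by rw [div_pow, mul_pow, mul_pow]; field_simp

/-- The terms of the Bessel-type series `∑ Yⁱ / (i! (ρ)ᵢ)`. -/
noncomputable def besselTerm (ρ Y : ℝ) (i : ℕ) : ℝ :=
  Y ^ i * (1 / (i.factorial * risingFactorial ρ i))

theorem abs_besselTerm {ρ Y : ℝ} (hρ : 0 < ρ) (i : ℕ) :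
    ‖besselTerm ρ Y i‖ = besselTerm ρ |Y| i := by
  have := risingFactorial_pos hρ i
  rw [besselTerm, besselTerm, norm_mul, norm_pow, Real.norm_eq_abs, Real.norm_eq_abs,
    abs_of_pos (a := 1 / _) (by positivity)]

theorem besselTerm_le {ρ κ Y : ℝ} (hκ : 0 < κ) (h : κ ≤ ρ) (hY : 0 ≤ Y) (i : ℕ) :
    besselTerm ρ Y i ≤ (Y / κ) ^ i / i.factorial := by
  have h1 := (pow_le_risingFactorial hκ i).trans (risingFactorial_le hκ h i)
  have hp := pow_pos hκ i
  have := risingFactorial_pos (hκ.trans_le h) i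
  calc _ ≤ Y ^ i * (1 / (i.factorial * κ ^ i)) := by unfold besselTerm; gcongr
    _ = _ := by rw [div_pow]; field_simp

theorem besselTerm_nonneg {ρ Y : ℝ} (hρ : 0 < ρ) (hY : 0 ≤ Y) (i : ℕ) : 0 ≤ besselTerm ρ Y i := by
  have := risingFactorial_pos hρ i
  unfold besselTerm; positivity

theorem summable_besselTerm {ρ : ℝ} (hρ : 0 < ρ) (Y : ℝ) : Summable fun i => ‖besselTerm ρ Y i‖ :=
  Summable.of_nonneg_of_le (fun i => norm_nonneg _)
    (fun i => by rw [abs_besselTerm hρ]; exact besselTerm_le hρ le_rfl (abs_nonneg Y) i)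
    (Real.summable_pow_div_factorial (|Y| / ρ))

theorem tsum_besselTerm_le {ρ κ Y : ℝ} (hκ : 0 < κ) (h : κ ≤ ρ) (hY : 0 ≤ Y) :
    ∑' i, besselTerm ρ Y i ≤ exp (Y / κ) := by
  rw [Real.exp_eq_exp_ℝ, NormedSpace.exp_eq_tsum_div]
  refine Summable.tsum_le_tsum (besselTerm_le hκ h hY) ?_ (Real.summable_pow_div_factorial _)
  simpa [abs_besselTerm (hκ.trans_le h), abs_of_nonneg hY] using
    summable_besselTerm (hκ.trans_le h) Y

/-- The coefficients of the square of the Bessel-type series. -/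
noncomputable def besselSqTerm (ρ Y : ℝ) (j : ℕ) : ℝ :=
  Y ^ j * (risingFactorial (2 * ρ + j - 1) j / (j.factorial * risingFactorial ρ j ^ 2))

theorem besselSqTerm_eq {ρ : ℝ} (hρ : 0 < ρ) (Y : ℝ) (j : ℕ) :
    besselSqTerm ρ Y j = ∑ p ∈ Finset.HasAntidiagonal.antidiagonal j,
      besselTerm ρ Y p.1 * besselTerm ρ Y p.2 := by
  rw [besselSqTerm, ← sum_antidiagonal_inv_risingFactorial hρ, Finset.mul_sum]
  refine Finset.sum_congr rfl fun p hp => ?_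
  rw [Finset.HasAntidiagonal.mem_antidiagonal] at hp
  rw [besselTerm, besselTerm, ← hp, pow_add]; ring

theorem abs_besselSqTerm {ρ : ℝ} (hρ : 0 < ρ) (Y : ℝ) (j : ℕ) :
    ‖besselSqTerm ρ Y j‖ = besselSqTerm ρ |Y| j := by
  have h : 0 ≤ risingFactorial (2 * ρ + j - 1) j := by
    cases j with
    | zero => simp [risingFactorial_zero]
    | succ j => exact (risingFactorial_pos (by push_cast; linarith [j.cast_nonneg (α := ℝ)]) _).le
  rw [besselSqTerm, besselSqTerm, norm_mul, norm_pow, Real.norm_eq_abs, Real.norm_eq_abs,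
    abs_of_nonneg (a := _ / _) (by positivity)]

theorem hasSum_besselSqTerm {ρ : ℝ} (hρ : 0 < ρ) (Y : ℝ) :
    HasSum (besselSqTerm ρ Y) ((∑' i, besselTerm ρ Y i) ^ 2) := by
  have h := summable_besselTerm hρ Y
  have h1 := summable_norm_sum_mul_antidiagonal_of_summable_norm h h
  rw [sq, tsum_mul_tsum_eq_tsum_sum_antidiagonal_of_summable_norm h h]
  rw [show besselSqTerm ρ Y = _ from funext (besselSqTerm_eq hρ Y)]
  exact h1.of_norm.hasSum

theorem squareNumer_mul_aux {A μ : ℝ} (hA : 0 < A) (hμ : 0 < μ) (X : ℝ) (n j : ℕ) :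
    squareCoeff A μ n * X ^ n * besselSqTerm ((A + μ - 1) / 2 + 1 + n) (-X) j =
      (-X) ^ (n + j) * risingFactorial (A + μ) (2 * (n + j)) /
        ((n + j).factorial * risingFactorial ((A + μ - 1) / 2 + 1) (n + j) ^ 2) *
        squareSummand A μ (n + j) n := by
  have hB : 0 < A + μ := by positivity
  have hκ : 0 < (A + μ - 1) / 2 + 1 := by linarith
  have hn : (0 : ℝ) ≤ n := n.cast_nonneg
  have h1 := (risingFactorial_pos hκ n).ne'
  have h2 := (risingFactorial_pos (show 0 < (A + μ - 1) / 2 + 1 + n by linarith) j).ne'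
  have h3 := (risingFactorial_pos hB (n + (n + j))).ne'
  have h4 : ((n + j).choose n : ℝ) * n.factorial * j.factorial = (n + j).factorial := by
    rw [Nat.choose_symm_add]
    exact_mod_cast Nat.add_choose_mul_factorial_mul_factorial n j
  have h5 : (-1 : ℝ) ^ n * (-1) ^ n = 1 := by rw [← mul_pow]; simp
  have h6 : (X : ℝ) ^ n = (-1) ^ n * (-X) ^ n := by rw [← mul_pow]; simp
  rw [squareCoeff, besselSqTerm, squareSummand, risingFactorial_add _ n j,
    show 2 * (n + j) = n + (n + j) + j by ring, risingFactorial_add _ (n + (n + j)) j,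
    show 2 * ((A + μ - 1) / 2 + 1 + n) + j - 1 = A + μ + ((n + (n + j) : ℕ) : ℝ) by push_cast; ring,
    ← h4, h6, pow_add]
  have h7 : ((n + j).choose n : ℝ) ≠ 0 := by
    exact_mod_cast (Nat.choose_pos (Nat.le_add_right n j)).ne'
  field_simp

/-- The coefficient identity behind the sum-of-squares expansion. -/
theorem sum_antidiagonal_squareCoeff {A μ : ℝ} (hA : 0 < A) (hμ : 0 < μ) (X : ℝ) (k : ℕ) :
    ∑ p ∈ Finset.HasAntidiagonal.antidiagonal k,
        squareCoeff A μ p.1 * X ^ p.1 * besselSqTerm ((A + μ - 1) / 2 + 1 + p.1) (-X) p.2 =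
      (-1) ^ k * risingFactorial A k * (16 * X) ^ k /
        (k.factorial * risingFactorial (2 * A + μ) (2 * k)) := by
  have h : ∀ p ∈ Finset.HasAntidiagonal.antidiagonal k,
      squareCoeff A μ p.1 * X ^ p.1 * besselSqTerm ((A + μ - 1) / 2 + 1 + p.1) (-X) p.2 =
      (-X) ^ k * risingFactorial (A + μ) (2 * k) /
        (k.factorial * risingFactorial ((A + μ - 1) / 2 + 1) k ^ 2) * squareSummand A μ k p.1 := by
    intro p hp
    rw [Finset.HasAntidiagonal.mem_antidiagonal] at hp
    rw [squareNumer_mul_aux hA hμ, hp]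
  rw [Finset.sum_congr rfl h, ← Finset.mul_sum,
    Finset.Nat.sum_antidiagonal_eq_sum_range_succ (fun i _ => squareSummand A μ k i),
    sum_squareSummand hA hμ, risingFactorial_two_mul, risingFactorial_two_mul,
    show (A + μ - 1) / 2 + 1 = (A + μ) / 2 + 1 / 2 by ring]
  have h1 := (risingFactorial_pos (show 0 < (A + μ) / 2 by positivity) k).ne'
  have h2 := (risingFactorial_pos (show 0 < (A + μ) / 2 + 1 / 2 by positivity) k).ne'
  have h3 := (risingFactorial_pos (show 0 < (2 * A + μ) / 2 by positivity) k).ne'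
  have h4 := (risingFactorial_pos (show 0 < (2 * A + μ) / 2 + 1 / 2 by positivity) k).ne'
  generalize risingFactorial ((A + μ) / 2) k = r₁ at *
  generalize risingFactorial ((A + μ) / 2 + 1 / 2) k = r₂ at *
  generalize risingFactorial ((2 * A + μ) / 2) k = r₃ at *
  generalize risingFactorial ((2 * A + μ) / 2 + 1 / 2) k = r₄ at *
  rw [mul_pow, neg_pow X, show (16 : ℝ) = 4 * 4 by norm_num, mul_pow]
  field_simp

/-- Positivity of the hypergeometric series `₁F₂`, via an expansion in squares of Bessel-type
series. -/
theorem tsum_hypergeometric_nonneg {A μ : ℝ} (hA : 0 < A) (h1 : A ≤ μ)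
    (h2 : 2 * A ≤ μ * (μ + 1)) {X : ℝ} (hX : 0 ≤ X) :
    0 ≤ ∑' k : ℕ, (-1) ^ k * risingFactorial A k * (16 * X) ^ k /
        (k.factorial * risingFactorial (2 * A + μ) (2 * k)) := by
  have hμ : 0 < μ := hA.trans_le h1
  have hκ : 0 < (A + μ - 1) / 2 + 1 := by linarith
  have hρ : ∀ n : ℕ, 0 < (A + μ - 1) / 2 + 1 + n := fun n => by positivity
  have hle : ∀ n : ℕ, (A + μ - 1) / 2 + 1 ≤ (A + μ - 1) / 2 + 1 + n := fun n => by simp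
  set w : ℕ × ℕ → ℝ := fun p =>
    squareCoeff A μ p.1 * X ^ p.1 * besselSqTerm ((A + μ - 1) / 2 + 1 + p.1) (-X) p.2 with hw
  have hc : ∀ n, 0 ≤ squareCoeff A μ n * X ^ n := fun n =>
    mul_nonneg (squareCoeff_nonneg hA h1 h2 n) (pow_nonneg hX n)
  have hnorm : ∀ n j, ‖w (n, j)‖ = squareCoeff A μ n * X ^ n *
      besselSqTerm ((A + μ - 1) / 2 + 1 + n) X j := fun n j => by
    rw [hw, norm_mul, abs_besselSqTerm (hρ n), abs_neg, abs_of_nonneg hX, Real.norm_of_nonneg (hc n)]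
  have hrow : ∀ n, HasSum (fun j => ‖w (n, j)‖) (squareCoeff A μ n * X ^ n *
      (∑' i, besselTerm ((A + μ - 1) / 2 + 1 + n) X i) ^ 2) := fun n => by
    simp only [hnorm]
    exact (hasSum_besselSqTerm (hρ n) X).mul_left _
  have hs : Summable w := by
    refine Summable.of_norm ?_
    rw [summable_prod_of_nonneg (fun p => norm_nonneg _)]
    refine ⟨fun n => (hrow n).summable, ?_⟩
    simp only [fun n => (hrow n).tsum_eq]
    refine Summable.of_nonneg_of_le (fun n => mul_nonneg (hc n) (sq_nonneg _)) (fun n => ?_)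
      ((summable_squareCoeff hA h1 h2 hX).mul_right (exp (X / ((A + μ - 1) / 2 + 1)) ^ 2))
    have := tsum_besselTerm_le hκ (hle n) hX
    have h0 : 0 ≤ ∑' i, besselTerm ((A + μ - 1) / 2 + 1 + n) X i :=
      tsum_nonneg (besselTerm_nonneg (hρ n) hX)
    exact mul_le_mul_of_nonneg_left (pow_le_pow_left₀ h0 this 2) (hc n)
  have hpos : 0 ≤ ∑' p, w p := by
    rw [hs.tsum_prod]
    refine tsum_nonneg fun n => ?_
    rw [hw]
    dsimp only
    rw [tsum_mul_left, (hasSum_besselSqTerm (hρ n) (-X)).tsum_eq]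
    exact mul_nonneg (hc n) (sq_nonneg _)
  have hs' := Finset.HasAntidiagonal.sigmaAntidiagonalEquivProd.summable_iff.mpr hs
  have he := hs'.tsum_sigma' fun k => (hasSum_fintype _).summable
  rw [← Finset.HasAntidiagonal.sigmaAntidiagonalEquivProd.tsum_eq] at hpos
  refine (hpos.trans_eq he).trans_eq (tsum_congr fun k => ?_)
  rw [← sum_antidiagonal_squareCoeff hA hμ X k, ← Finset.sum_coe_sort, tsum_fintype]
  rfl

theorem lintegral_ofReal_eq_of_integral_eq {α : Type*} [MeasurableSpace α] {μ : Measure α}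
    {f : α → ℝ} {v : ℝ} (hf : 0 ≤ᵐ[μ] f) (hv : v ≠ 0) (h : ∫ x, f x ∂μ = v) :
    ∫⁻ x, ENNReal.ofReal (f x) ∂μ = ENNReal.ofReal v := by
  rw [← h, ofReal_integral_eq_lintegral_ofReal (.of_integral_ne_zero (h ▸ hv)) hf]

theorem lintegral_rpow_mul_exp_neg_mul_Ioi {a r : ℝ} (ha : 0 < a) (hr : 0 < r) :
    ∫⁻ t in Set.Ioi (0 : ℝ), ENNReal.ofReal (t ^ (a - 1) * exp (-(r * t))) =
      ENNReal.ofReal ((1 / r) ^ a * Gamma a) := by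
  have := Gamma_pos_of_pos ha
  refine lintegral_ofReal_eq_of_integral_eq ?_ (by positivity)
    (integral_rpow_mul_exp_neg_mul_Ioi ha hr)
  refine (ae_restrict_iff' measurableSet_Ioi).mpr (ae_of_all _ fun t ht => ?_)
  have ht : 0 < t := ht
  show 0 ≤ _
  positivity

/-- The terms of the power series of the inverse Laplace transform of
`λ ^ (-m) * (1 + λ ^ (-2)) ^ (-A)`. -/
noncomputable def invLaplaceTerm (A m : ℝ) (k : ℕ) (t : ℝ) : ℝ :=
  (-1) ^ k * (risingFactorial A k / k.factorial) * (t ^ (m + 2 * k - 1) / Gamma (m + 2 * k))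

theorem tsum_invLaplaceTerm_nonneg {A μ : ℝ} (hA : 0 < A) (h1 : A ≤ μ)
    (h2 : 2 * A ≤ μ * (μ + 1)) {t : ℝ} (ht : 0 < t) :
    0 ≤ ∑' k, invLaplaceTerm A (2 * A + μ) k t := by
  have hm : 0 < 2 * A + μ := by linarith
  have h := tsum_hypergeometric_nonneg hA h1 h2 (show 0 ≤ t ^ 2 / 16 by positivity)
  have hΓ := Gamma_pos_of_pos hm
  refine (mul_nonneg (show 0 ≤ t ^ (2 * A + μ - 1) / Gamma (2 * A + μ) by positivity) h).trans_eq ?_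
  rw [← tsum_mul_left]
  refine tsum_congr fun k => ?_
  have hr := risingFactorial_pos hm (2 * k)
  have hG := Gamma_add_natCast hm (2 * k)
  push_cast at hG
  rw [invLaplaceTerm, hG, show 2 * A + μ + 2 * (k : ℝ) - 1 = 2 * A + μ - 1 + (2 * k : ℕ) by
    push_cast; ring, rpow_add_natCast ht.ne', pow_mul, mul_div_cancel₀ _ (by norm_num : (16 : ℝ) ≠ 0)]
  field_simp

theorem hasSum_one_div_one_sub_rpow {A x : ℝ} (hx : |x| < 1) :
    HasSum (fun k : ℕ => risingFactorial A k / k.factorial * x ^ k) (1 / (1 - x) ^ A) := by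
  have h := (Real.one_div_one_sub_rpow_hasFPowerSeriesOnBall_zero A).hasSum (y := x)
    (by simpa [← ofReal_norm, ENNReal.ofReal_lt_one] using hx)
  simpa [FormalMultilinearSeries.ofScalars_apply_eq, ringChoose_eq_risingFactorial_div, mul_comm]
    using h

theorem integral_tsum_invLaplaceTerm {A m r : ℝ} (hA : 0 < A) (hm : 0 < m) (hr : 1 < r) :
    ∫ t in Set.Ioi (0 : ℝ), ∑' k, exp (-(r * t)) * invLaplaceTerm A m k t =
      r ^ (-m) * (1 / (1 + (r ^ 2)⁻¹) ^ A) := by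
  have hr0 : 0 < r := one_pos.trans hr
  have hmk : ∀ k : ℕ, 0 < m + 2 * k := fun k => by positivity
  have hx : (r ^ 2)⁻¹ < 1 := inv_lt_one_of_one_lt₀ (one_lt_pow₀ hr two_ne_zero)
  have hx0 : 0 < (r ^ 2)⁻¹ := by positivity
  have hF : ∀ k, (fun t => exp (-(r * t)) * invLaplaceTerm A m k t) = fun t =>
      (-1) ^ k * (risingFactorial A k / k.factorial) / Gamma (m + 2 * k) *
        (t ^ (m + 2 * k - 1) * exp (-(r * t))) := fun k => by
    funext t; rw [invLaplaceTerm]; ring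
  have hInt : ∀ k : ℕ, IntegrableOn (fun t => t ^ (m + 2 * k - 1) * exp (-(r * t)))
      (Set.Ioi (0 : ℝ)) := fun k => .of_integral_ne_zero (by
    rw [integral_rpow_mul_exp_neg_mul_Ioi (hmk k) hr0]
    have := Gamma_pos_of_pos (hmk k)
    positivity)
  have hrk : ∀ k : ℕ, (1 / r) ^ (m + 2 * k) = r ^ (-m) * ((r ^ 2)⁻¹) ^ k := fun k => by
    rw [one_div, inv_rpow hr0.le, ← rpow_neg hr0.le, neg_add, rpow_add hr0,
      ← rpow_natCast (r ^ 2)⁻¹ k, inv_rpow (by positivity), ← rpow_neg (by positivity),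
      ← rpow_natCast r 2, ← rpow_mul hr0.le]
    push_cast; ring_nf
  have hi : ∀ k, ∫ t in Set.Ioi (0 : ℝ), exp (-(r * t)) * invLaplaceTerm A m k t =
      r ^ (-m) * (risingFactorial A k / k.factorial * (-(r ^ 2)⁻¹) ^ k) := fun k => by
    have := Gamma_pos_of_pos (hmk k)
    rw [hF, integral_const_mul, integral_rpow_mul_exp_neg_mul_Ioi (hmk k) hr0, hrk, neg_pow (r ^ 2)⁻¹]
    field_simp
  have hn : ∀ k, ∫ t in Set.Ioi (0 : ℝ), ‖exp (-(r * t)) * invLaplaceTerm A m k t‖ =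
      r ^ (-m) * (risingFactorial A k / k.factorial * ((r ^ 2)⁻¹) ^ k) := fun k => by
    have := Gamma_pos_of_pos (hmk k)
    have hp := risingFactorial_pos hA k
    have e : ∀ t ∈ Set.Ioi (0 : ℝ), ‖exp (-(r * t)) * invLaplaceTerm A m k t‖ =
        (risingFactorial A k / k.factorial) / Gamma (m + 2 * k) *
        (t ^ (m + 2 * k - 1) * exp (-(r * t))) := fun t ht => by
      have ht : 0 < t := ht
      rw [congrFun (hF k) t, norm_mul, norm_div, norm_mul, norm_pow, norm_neg, norm_one, one_pow,
        one_mul, Real.norm_of_nonneg, Real.norm_of_nonneg, Real.norm_of_nonneg] <;> positivity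
    rw [setIntegral_congr_fun measurableSet_Ioi e, integral_const_mul,
      integral_rpow_mul_exp_neg_mul_Ioi (hmk k) hr0, hrk]
    field_simp
  have h := hasSum_integral_of_summable_integral_norm (μ := volume.restrict (Set.Ioi (0 : ℝ)))
    (F := fun k t => exp (-(r * t)) * invLaplaceTerm A m k t)
    (fun k => by rw [hF]; exact (hInt k).const_mul _)
    (by
      simp only [hn]
      exact ((hasSum_one_div_one_sub_rpow (A := A) (x := (r ^ 2)⁻¹)
        (by rwa [abs_of_pos hx0])).summable).mul_left _)
  simp only [hi] at h
  have h' := (hasSum_one_div_one_sub_rpow (A := A) (x := -(r ^ 2)⁻¹)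
        (by rwa [abs_neg, abs_of_pos hx0])).mul_left (r ^ (-m))
  rw [sub_neg_eq_add] at h'
  exact h.unique h'

/-- `λ ^ (-μ) * (1 + λ ^ 2) ^ (-A)` is the Laplace transform of a measure, for `λ > 1`. -/
theorem exists_laplace_of_one_lt {A μ : ℝ} (hA : 0 < A) (h1 : A ≤ μ)
    (h2 : 2 * A ≤ μ * (μ + 1)) :
    ∃ ρ : Measure ℝ, SFinite ρ ∧ ρ (Set.Ioi 0)ᶜ = 0 ∧ ∀ r : ℝ, 1 < r →
      ∫⁻ t, ENNReal.ofReal (exp (-(r * t))) ∂ρ =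
        ENNReal.ofReal (r ^ (-μ) * (1 + r ^ 2) ^ (-A)) := by
  have hm : 0 < 2 * A + μ := by linarith
  set y : ℝ → ℝ := fun t => ∑' k, invLaplaceTerm A (2 * A + μ) k t with hy
  have hy0 : ∀ᵐ t ∂(volume.restrict (Set.Ioi (0 : ℝ))), 0 ≤ y t :=
    (ae_restrict_iff' measurableSet_Ioi).mpr
      (ae_of_all _ fun t ht => tsum_invLaplaceTerm_nonneg hA h1 h2 ht)
  have key : ∀ r : ℝ, 1 < r → ∫ t in Set.Ioi (0 : ℝ), exp (-(r * t)) * y t =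
      r ^ (-μ) * (1 + r ^ 2) ^ (-A) := fun r hr => by
    have hr0 : 0 < r := one_pos.trans hr
    have := integral_tsum_invLaplaceTerm hA hm hr
    simp only [tsum_mul_left] at this
    rw [this, show 1 + (r ^ 2)⁻¹ = (r ^ 2)⁻¹ * (1 + r ^ 2) by field_simp; ring,
      mul_rpow (by positivity) (by positivity), one_div, mul_inv, ← rpow_neg (by positivity),
      ← rpow_neg (by positivity), inv_rpow (by positivity), ← rpow_neg (by positivity), ← mul_assoc,
      ← rpow_natCast r 2, ← rpow_mul hr0.le, ← rpow_add hr0]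
    congr 2
    push_cast; ring
  have hmeas : AEMeasurable y (volume.restrict (Set.Ioi (0 : ℝ))) := by
    have hi : Integrable (fun t => exp (-(2 * t)) * y t) (volume.restrict (Set.Ioi (0 : ℝ))) :=
      .of_integral_ne_zero (by rw [key 2 one_lt_two]; positivity)
    have e : y = fun t => exp (2 * t) * (exp (-(2 * t)) * y t) := by
      funext t; rw [← mul_assoc, ← exp_add]; simp
    rw [e]
    exact (by fun_prop : Measurable fun t : ℝ => exp (2 * t)).aemeasurable.mul
      hi.aestronglyMeasurable.aemeasurable
  refine ⟨(volume.restrict (Set.Ioi (0 : ℝ))).withDensity fun t => ENNReal.ofReal (y t),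
    inferInstance, ?_, fun r hr => ?_⟩
  · refine withDensity_absolutelyContinuous _ _ ?_
    rw [Measure.restrict_apply measurableSet_Ioi.compl, Set.compl_inter_self, measure_empty]
  · have hr0 : 0 < r := one_pos.trans hr
    rw [lintegral_withDensity_eq_lintegral_mul₀ hmeas.ennreal_ofReal (by fun_prop),
      ← lintegral_ofReal_eq_of_integral_eq (hy0.mono fun t ht => ?_) (by positivity) (key r hr)]
    · refine lintegral_congr fun t => ?_
      rw [Pi.mul_apply, mul_comm, ← ENNReal.ofReal_mul (exp_pos _).le]
    · exact mul_nonneg (exp_pos _).le ht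

theorem lintegral_exp_mul_eq_of_lt_neg_one {ρ : Measure ℝ} (hρ : ρ (Set.Ioi 0)ᶜ = 0)
    {f : ℂ → ℂ} {φ : ℝ → ℝ} (hf : DifferentiableOn ℂ f {z | z.re < 0})
    (hφ : ∀ x : ℝ, x < 0 → f x = φ x) (hpos : ∀ x < 0, 0 < φ x)
    (h : ∀ x < -1, ∫⁻ t, ENNReal.ofReal (exp (x * t)) ∂ρ = ENNReal.ofReal (φ x))
    {x : ℝ} (hx : x < 0) : ∫⁻ t, ENNReal.ofReal (exp (x * t)) ∂ρ = ENNReal.ofReal (φ x) := by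
  rcases lt_or_ge x (-1) with hx1 | hx1
  · exact h x hx1
  have hmgf : ∀ x < -1, Integrable (fun t => exp (x * t)) ρ ∧ ∫ t, exp (x * t) ∂ρ = φ x := by
    intro x hx
    have hi : Integrable (fun t => exp (x * t)) ρ :=
      ⟨by fun_prop, by
        rw [hasFiniteIntegral_iff_ofReal (ae_of_all _ fun t => (exp_pos _).le), h x hx]
        exact ENNReal.ofReal_lt_top⟩
    refine ⟨hi, ?_⟩
    have h1 := ofReal_integral_eq_lintegral_ofReal hi (ae_of_all _ fun t => (exp_pos _).le)
    rw [h x hx, ENNReal.ofReal_eq_ofReal_iff (integral_nonneg fun t => (exp_pos _).le)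
      (hpos x (by linarith)).le] at h1
    exact h1
  have hInt : (-2 : ℝ) ∈ interior (ProbabilityTheory.integrableExpSet id ρ) :=
    interior_maximal (t := Set.Iio (-1 : ℝ)) (fun x hx => (hmgf x hx).1) isOpen_Iio
      (show (-2 : ℝ) < -1 by norm_num)
  have hser := ProbabilityTheory.hasFPowerSeriesAt_mgf hInt
  have hR : 0 ≤ (x + 4) / 2 := by linarith
  lift (x + 4) / 2 to NNReal using hR with R hRx
  have hR0 : 0 < R := by rw [← NNReal.coe_pos, hRx]; linarith
  have hball : Metric.closedBall (-2 : ℂ) R ⊆ {z | z.re < 0} := by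
    intro z hz
    rw [mem_closedBall_iff_norm] at hz
    have := (Complex.abs_re_le_norm (z - -2)).trans hz
    have h2 := (abs_le.mp this).2
    simp only [Complex.sub_re, Complex.neg_re, Complex.re_ofNat] at h2
    show z.re < 0
    linarith
  have hc := ((hf.mono hball).hasFPowerSeriesOnBall hR0).restrictScalars (𝕜 := ℝ)
  rw [show (-2 : ℂ) = Complex.ofRealCLM (-2) by simp] at hc
  have hc' := Complex.reCLM.comp_hasFPowerSeriesOnBall hc.compContinuousLinearMap
  have heq := HasFPowerSeriesAt.eq_formalMultilinearSeries_of_eventually hser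
    hc'.hasFPowerSeriesAt (by
      filter_upwards [Iio_mem_nhds (show (-2 : ℝ) < -1 by norm_num)] with u hu
      have hu : u < -1 := hu
      simp only [ProbabilityTheory.mgf, id, Function.comp_apply, Complex.ofRealCLM_apply,
        Complex.reCLM_apply]
      rw [(hmgf u hu).2, hφ u (by linarith), Complex.ofReal_re])
  rw [← heq] at hc'
  have hsum := hc'.hasSum (y := x + 2) (by
    simp only [Complex.ofRealCLM_enorm, div_one]
    rw [mem_eball_zero_iff, ← ofReal_norm, Real.norm_of_nonneg (by linarith),
      ← ENNReal.ofReal_coe_nnreal, hRx]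
    exact (ENNReal.ofReal_lt_ofReal_iff (by linarith)).mpr (by linarith))
  simp only [Function.comp_apply, Complex.ofRealCLM_apply, Complex.reCLM_apply,
    FormalMultilinearSeries.ofScalars_apply_eq, id, smul_eq_mul] at hsum
  rw [show -2 + (x + 2) = x by ring, hφ x hx, Complex.ofReal_re] at hsum
  have hnn : ∀ (n : ℕ), 0 ≤ᵐ[ρ] fun t => (x + 2) ^ n / n.factorial * (t ^ n * exp (-2 * t)) := by
    intro n
    have : ∀ᵐ t ∂ρ, t ∈ Set.Ioi (0 : ℝ) := by rwa [ae_iff]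
    filter_upwards [this] with t ht
    have ht : 0 < t := ht
    have : 0 < x + 2 := by linarith
    show 0 ≤ _
    positivity
  have hterm : ∀ n : ℕ, ∫⁻ t, ENNReal.ofReal
      ((x + 2) ^ n / n.factorial * (t ^ n * exp (-2 * t))) ∂ρ =
      ENNReal.ofReal ((∫ t, t ^ n * exp (-2 * t) ∂ρ) / n.factorial * (x + 2) ^ n) := by
    intro n
    have hi : Integrable (fun t : ℝ => t ^ n * exp (-2 * t)) ρ :=
      ProbabilityTheory.integrable_pow_mul_exp_of_mem_interior_integrableExpSet hInt n
    rw [← ofReal_integral_eq_lintegral_ofReal (hi.const_mul _) (hnn n), integral_const_mul]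
    congr 1
    ring
  have hnn' : ∀ n : ℕ, 0 ≤ (∫ t, t ^ n * exp (-2 * t) ∂ρ) / n.factorial * (x + 2) ^ n := by
    intro n
    have := integral_nonneg_of_ae (hnn n)
    rw [integral_const_mul] at this
    refine this.trans_eq (by ring)
  calc _ = ∫⁻ t, ∑' n : ℕ, ENNReal.ofReal
        ((x + 2) ^ n / n.factorial * (t ^ n * exp (-2 * t))) ∂ρ := by
        refine lintegral_congr_ae ?_
        filter_upwards [ae_all_iff.mpr hnn] with t ht
        have hs := (NormedSpace.expSeries_div_hasSum_exp ((x + 2) * t)).mul_right (exp (-2 * t))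
        rw [← Real.exp_eq_exp_ℝ, ← exp_add, show (x + 2) * t + -2 * t = x * t by ring] at hs
        have e : (fun n : ℕ => ((x + 2) * t) ^ n / n.factorial * exp (-2 * t)) =
            fun n : ℕ => (x + 2) ^ n / n.factorial * (t ^ n * exp (-2 * t)) := by
          funext n
          rw [mul_pow]
          ring
        rw [e] at hs
        rw [← hs.tsum_eq, ENNReal.ofReal_tsum_of_nonneg ht hs.summable]
    _ = ∑' n : ℕ, ENNReal.ofReal ((∫ t, t ^ n * exp (-2 * t) ∂ρ) / n.factorial * (x + 2) ^ n) := by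
        rw [lintegral_tsum fun n => by fun_prop]
        exact tsum_congr hterm
    _ = _ := by rw [← ENNReal.ofReal_tsum_of_nonneg hnn' hsum.summable, hsum.tsum_eq]

theorem exists_laplace {A μ : ℝ} (hA : 0 < A) (h1 : A ≤ μ) (h2 : 2 * A ≤ μ * (μ + 1)) :
    ∃ ρ : Measure ℝ, SFinite ρ ∧ ρ (Set.Ioi 0)ᶜ = 0 ∧ ∀ r : ℝ, 0 < r →
      ∫⁻ t, ENNReal.ofReal (exp (-(r * t))) ∂ρ =
        ENNReal.ofReal (r ^ (-μ) * (1 + r ^ 2) ^ (-A)) := by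
  obtain ⟨ρ, hs, hρ, h⟩ := exists_laplace_of_one_lt hA h1 h2
  refine ⟨ρ, hs, hρ, fun r hr => ?_⟩
  have := lintegral_exp_mul_eq_of_lt_neg_one hρ
    (f := fun z => (-z) ^ (-μ : ℂ) * (1 + z ^ 2) ^ (-A : ℂ))
    (φ := fun x => (-x) ^ (-μ) * (1 + x ^ 2) ^ (-A)) ?_ ?_ ?_ ?_ (neg_neg_of_pos hr)
  · simpa only [neg_mul, neg_neg, neg_sq] using this
  · intro z hz
    have hz : z.re < 0 := hz
    refine DifferentiableAt.differentiableWithinAt ?_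
    refine (DifferentiableAt.cpow_const (by fun_prop) (Or.inl (by simpa using hz))).mul
      (DifferentiableAt.cpow_const (by fun_prop) ?_)
    rw [Complex.mem_slitPlane_iff]
    by_contra! hcon
    simp only [sq, Complex.add_re, Complex.one_re, Complex.mul_re, Complex.add_im, Complex.one_im,
      Complex.mul_im] at hcon
    have him : z.im = 0 := by
      have : z.re * z.im = 0 := by linarith [hcon.2]
      exact (mul_eq_zero.mp this).resolve_left hz.ne
    rw [him] at hcon
    nlinarith [hcon.1]
  · intro x hx
    push_cast
    rw [Complex.ofReal_cpow (by linarith), Complex.ofReal_cpow (by positivity)]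
    push_cast; rfl
  · intro x hx
    have : 0 < -x := by linarith
    positivity
  · intro x hx
    have := h (-x) (by linarith)
    simpa only [neg_mul, neg_neg, neg_sq] using this

theorem lintegral_rpow_mul_one_add_sq_rpow_neg {A q : ℝ} (hq : 0 < q) (hqA : q < A) :
    ∫⁻ r in Set.Ioi (0 : ℝ), ENNReal.ofReal (r ^ (2 * q - 1) * (1 + r ^ 2) ^ (-A)) =
      ENNReal.ofReal (Gamma q * Gamma (A - q) / (2 * Gamma A)) := by
  have hA : 0 < A := hq.trans hqA
  have hΓA := Gamma_pos_of_pos hA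
  have hΓq := Gamma_pos_of_pos hq
  have hΓs := Gamma_pos_of_pos (sub_pos.mpr hqA)
  have inner : ∀ u ∈ Set.Ioi (0 : ℝ), ∫⁻ r in Set.Ioi (0 : ℝ),
      ENNReal.ofReal (r ^ (2 * q - 1) * (u ^ (A - 1) * exp (-((1 + r ^ 2) * u)))) =
      ENNReal.ofReal (Gamma q / 2) * ENNReal.ofReal (u ^ (A - q - 1) * exp (-(1 * u))) := by
    intro u hu
    have hu : 0 < u := hu
    have h := integral_rpow_mul_exp_neg_mul_rpow (p := 2) (q := 2 * q - 1) (b := u) two_pos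
      (by linarith) hu
    rw [show (2 * q - 1 + 1) / 2 = q by ring, show -(2 * q - 1 + 1) / 2 = -q by ring] at h
    have h' := lintegral_ofReal_eq_of_integral_eq (μ := volume.restrict (Set.Ioi (0 : ℝ)))
      ((ae_restrict_iff' measurableSet_Ioi).mpr (ae_of_all _ fun t (ht : 0 < t) => by
        show 0 ≤ _; positivity)) (by positivity) h
    calc _ = ∫⁻ r in Set.Ioi (0 : ℝ), ENNReal.ofReal (u ^ (A - 1) * exp (-u)) *
          ENNReal.ofReal (r ^ (2 * q - 1) * exp (-u * r ^ (2 : ℝ))) := by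
          refine lintegral_congr fun r => ?_
          rw [← ENNReal.ofReal_mul (by positivity), rpow_two,
            show -((1 + r ^ 2) * u) = -u + -u * r ^ 2 by ring, exp_add]
          congr 1
          ring
      _ = _ := by
          rw [lintegral_const_mul _ (by fun_prop), h', ← ENNReal.ofReal_mul (by positivity),
            ← ENNReal.ofReal_mul (by positivity), show A - q - 1 = (A - 1) + -q by ring,
            rpow_add hu, one_mul]
          congr 1
          ring
  have outer : ∀ r ∈ Set.Ioi (0 : ℝ), ENNReal.ofReal (Gamma A) *
      ENNReal.ofReal (r ^ (2 * q - 1) * (1 + r ^ 2) ^ (-A)) = ∫⁻ u in Set.Ioi (0 : ℝ),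
      ENNReal.ofReal (r ^ (2 * q - 1) * (u ^ (A - 1) * exp (-((1 + r ^ 2) * u)))) := by
    intro r hr
    have hr : 0 < r := hr
    have h1 : 0 < 1 + r ^ 2 := by positivity
    have e : ∀ u : ℝ, ENNReal.ofReal (r ^ (2 * q - 1) * (u ^ (A - 1) * exp (-((1 + r ^ 2) * u)))) =
        ENNReal.ofReal (r ^ (2 * q - 1)) *
          ENNReal.ofReal (u ^ (A - 1) * exp (-((1 + r ^ 2) * u))) :=
      fun u => ENNReal.ofReal_mul (by positivity)
    simp only [e]
    rw [lintegral_const_mul _ (by fun_prop), lintegral_rpow_mul_exp_neg_mul_Ioi hA h1,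
      ← ENNReal.ofReal_mul (by positivity), ← ENNReal.ofReal_mul (by positivity), one_div,
      inv_rpow h1.le, ← rpow_neg h1.le]
    congr 1
    ring
  have total : ENNReal.ofReal (Gamma A) * ∫⁻ r in Set.Ioi (0 : ℝ),
      ENNReal.ofReal (r ^ (2 * q - 1) * (1 + r ^ 2) ^ (-A)) =
      ENNReal.ofReal (Gamma q / 2) * ENNReal.ofReal (Gamma (A - q)) := by
    rw [← lintegral_const_mul _ (by fun_prop), setLIntegral_congr_fun measurableSet_Ioi outer,
      lintegral_lintegral_swap (by fun_prop), setLIntegral_congr_fun measurableSet_Ioi inner,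
      lintegral_const_mul _ (by fun_prop),
      lintegral_rpow_mul_exp_neg_mul_Ioi (sub_pos.mpr hqA) one_pos]
    simp
  rw [← ENNReal.mul_right_inj (a := ENNReal.ofReal (Gamma A)) (by simpa using hΓA)
    ENNReal.ofReal_ne_top, total, ← ENNReal.ofReal_mul (by positivity),
    ← ENNReal.ofReal_mul (by positivity)]
  congr 1
  field_simp

/-- The negative moments of a measure with Laplace transform `r ^ (-μ) * (1 + r ^ 2) ^ (-A)`. -/
theorem lintegral_rpow_neg_of_laplace {A μ q : ℝ} (hμ : 0 < μ) (hq : 0 < q) (hqA : q < A)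
    {ρ : Measure ℝ} [SFinite ρ] (hρ : ρ (Set.Ioi 0)ᶜ = 0)
    (h : ∀ r : ℝ, 0 < r → ∫⁻ t, ENNReal.ofReal (exp (-(r * t))) ∂ρ =
        ENNReal.ofReal (r ^ (-μ) * (1 + r ^ 2) ^ (-A))) :
    ∫⁻ t, ENNReal.ofReal (t ^ (-(μ + 2 * q))) ∂ρ =
      ENNReal.ofReal (Gamma q * Gamma (A - q) / (2 * Gamma A * Gamma (μ + 2 * q))) := by
  have hσ : 0 < μ + 2 * q := by positivity
  have hΓσ := Gamma_pos_of_pos hσ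
  have hΓA := Gamma_pos_of_pos (hq.trans hqA)
  have hΓq := Gamma_pos_of_pos hq
  have hΓs := Gamma_pos_of_pos (sub_pos.mpr hqA)
  have total : ENNReal.ofReal (Gamma (μ + 2 * q)) * ∫⁻ t, ENNReal.ofReal (t ^ (-(μ + 2 * q))) ∂ρ =
      ENNReal.ofReal (Gamma q * Gamma (A - q) / (2 * Gamma A)) := by
    rw [← lintegral_const_mul _ (by fun_prop)]
    calc _ = ∫⁻ t, (∫⁻ r in Set.Ioi (0 : ℝ),
          ENNReal.ofReal (r ^ (μ + 2 * q - 1) * exp (-(t * r)))) ∂ρ := by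
          refine lintegral_congr_ae ?_
          have : ∀ᵐ t ∂ρ, t ∈ Set.Ioi (0 : ℝ) := by rwa [ae_iff]
          filter_upwards [this] with t ht
          have ht : 0 < t := ht
          rw [lintegral_rpow_mul_exp_neg_mul_Ioi hσ ht, ← ENNReal.ofReal_mul (by positivity),
            one_div, inv_rpow ht.le, ← rpow_neg ht.le, mul_comm]
      _ = ∫⁻ r in Set.Ioi (0 : ℝ), ∫⁻ t,
          ENNReal.ofReal (r ^ (μ + 2 * q - 1) * exp (-(t * r))) ∂ρ :=
          lintegral_lintegral_swap (by fun_prop)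
      _ = ∫⁻ r in Set.Ioi (0 : ℝ), ENNReal.ofReal (r ^ (2 * q - 1) * (1 + r ^ 2) ^ (-A)) := by
          refine setLIntegral_congr_fun measurableSet_Ioi fun r hr => ?_
          have hr : 0 < r := hr
          have e : ∀ t, ENNReal.ofReal (r ^ (μ + 2 * q - 1) * exp (-(t * r))) =
              ENNReal.ofReal (r ^ (μ + 2 * q - 1)) * ENNReal.ofReal (exp (-(r * t))) := fun t => by
            rw [mul_comm t r, ENNReal.ofReal_mul (by positivity)]
          simp only [e]
          rw [lintegral_const_mul _ (by fun_prop), h r hr, ← ENNReal.ofReal_mul (by positivity),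
            ← mul_assoc, ← rpow_add hr]
          congr 3
          ring
      _ = _ := lintegral_rpow_mul_one_add_sq_rpow_neg hq hqA
  rw [← ENNReal.mul_right_inj (a := ENNReal.ofReal (Gamma (μ + 2 * q))) (by simpa using hΓσ)
    ENNReal.ofReal_ne_top, total, ← ENNReal.ofReal_mul (by positivity)]
  congr 1
  field_simp

/-- `φ` gives the positive moments of a probability measure on `[0, ∞)`. -/
def HasMoments (φ : ℝ → ENNReal) : Prop :=
  ∃ ν : ProbabilityMeasure NNReal, ∀ t : ℝ, 0 < t →
    ∫⁻ x, ((x ^ t : NNReal) : ENNReal) ∂(ν : Measure NNReal) = φ t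

theorem HasMoments.mul {φ ψ : ℝ → ENNReal} (hφ : HasMoments φ) (hψ : HasMoments ψ) :
    HasMoments fun t => φ t * ψ t := by
  obtain ⟨ν, hν⟩ := hφ
  obtain ⟨κ, hκ⟩ := hψ
  refine ⟨⟨((ν : Measure NNReal).prod κ).map fun p => p.1 * p.2,
    Measure.isProbabilityMeasure_map (by fun_prop)⟩, fun t ht => ?_⟩
  rw [ProbabilityMeasure.coe_mk, lintegral_map (by fun_prop) (by fun_prop)]
  simp only [NNReal.mul_rpow, ENNReal.coe_mul]
  rw [lintegral_prod_mul (f := fun x : NNReal => ((x ^ t : NNReal) : ENNReal))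
    (g := fun x : NNReal => ((x ^ t : NNReal) : ENNReal)) (by fun_prop) (by fun_prop), hν t ht,
    hκ t ht]

theorem hasMoments_const_rpow (x : NNReal) : HasMoments fun t => ((x ^ t : NNReal) : ENNReal) :=
  ⟨⟨Measure.dirac x, inferInstance⟩, fun t _ => by
    rw [ProbabilityMeasure.coe_mk, lintegral_dirac]⟩

theorem hasMoments_add_mul_div_add {α k : ℝ} (h0 : 0 ≤ α) (h1 : α ≤ 1) (hk : 0 < k) :
    HasMoments fun t => ENNReal.ofReal ((k + α * t) / (k + t)) := by
  set κ : Measure NNReal := (volume.restrict (Set.Ioc (0 : ℝ) 1)).map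
    fun u => u.toNNReal ^ (1 / k) with hκ
  have hm : Measurable fun u : ℝ => u.toNNReal ^ (1 / k) := by fun_prop
  have hκp : IsProbabilityMeasure κ := by
    have : IsProbabilityMeasure (volume.restrict (Set.Ioc (0 : ℝ) 1)) := ⟨by simp⟩
    exact Measure.isProbabilityMeasure_map hm.aemeasurable
  have hp : IsProbabilityMeasure (ENNReal.ofReal α • Measure.dirac (1 : NNReal) +
      ENNReal.ofReal (1 - α) • κ) := ⟨by
    simp only [Measure.add_apply, Measure.smul_apply, measure_univ, smul_eq_mul, mul_one]
    rw [← ENNReal.ofReal_add h0 (sub_nonneg.mpr h1)]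
    simp⟩
  refine ⟨⟨_, hp⟩, fun t ht => ?_⟩
  have hκt : ∫⁻ x, ((x ^ t : NNReal) : ENNReal) ∂κ = ENNReal.ofReal (k / (k + t)) := by
    rw [hκ, lintegral_map (by fun_prop) hm, ← lintegral_ofReal_eq_of_integral_eq
      (f := fun u => u ^ (t / k)) (μ := volume.restrict (Set.Ioc (0 : ℝ) 1)) ?_
      (by positivity) ?_]
    · refine setLIntegral_congr_fun measurableSet_Ioc fun u hu => ?_
      show ((_ : NNReal) : ENNReal) = _
      rw [← NNReal.rpow_mul, ENNReal.ofReal]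
      congr 1
      rw [Real.toNNReal_rpow_of_nonneg hu.1.le]
      congr 1
      field_simp
    · exact (ae_restrict_iff' measurableSet_Ioc).mpr (ae_of_all _ fun u hu =>
        rpow_nonneg hu.1.le _)
    · have : 0 < t / k := by positivity
      rw [← intervalIntegral.integral_of_le zero_le_one,
        integral_rpow (Or.inl (by linarith)), one_rpow, zero_rpow (by positivity)]
      field_simp
      ring
  rw [ProbabilityMeasure.coe_mk, lintegral_add_measure, lintegral_smul_measure,
    lintegral_smul_measure, lintegral_dirac, hκt, NNReal.one_rpow, smul_eq_mul, smul_eq_mul,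
    ENNReal.coe_one, mul_one, ← ENNReal.ofReal_mul (sub_nonneg.mpr h1),
    ← ENNReal.ofReal_add h0 (mul_nonneg (sub_nonneg.mpr h1) (by positivity))]
  congr 1
  field_simp
  ring

open Filter Topology in
theorem HasMoments.of_tendsto {φ : ℕ → ℝ → ENNReal} {ψ : ℝ → ENNReal}
    (h : ∀ n, HasMoments (φ n)) (hfin : ∀ n, φ n 1 ≠ ⊤) (hψ : ∀ t, 0 < t → ψ t ≠ ⊤)
    (hlim : ∀ t, 0 < t → Tendsto (fun n => φ n t) atTop (𝓝 (ψ t))) : HasMoments ψ := by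
  choose ν hν using h
  obtain ⟨C, hC⟩ : ∃ C : NNReal, ∀ n, φ n 1 ≤ C := by
    have h1 := (hlim 1 one_pos).eventually_lt_const
      (ENNReal.lt_add_right (hψ 1 one_pos) one_ne_zero)
    obtain ⟨N, hN⟩ := eventually_atTop.mp h1
    refine ⟨(ψ 1).toNNReal + 1 + ∑ i ∈ Finset.range N, (φ i 1).toNNReal, fun n => ?_⟩
    rcases le_or_gt N n with hn | hn
    · exact (hN n hn).le.trans (by
        push_cast
        rw [ENNReal.coe_toNNReal (hψ 1 one_pos)]
        exact le_self_add)
    · rw [← ENNReal.coe_toNNReal (hfin n)]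
      exact_mod_cast (Finset.single_le_sum (f := fun i => (φ i 1).toNNReal)
        (fun i _ => zero_le) (Finset.mem_range.mpr hn)).trans le_add_self
  have htight : IsTightMeasureSet {x : Measure NNReal | ∃ μ ∈ Set.range ν, (μ : Measure NNReal) = x} := by
    rw [isTightMeasureSet_iff_exists_isCompact_measure_compl_le]
    intro ε hε
    obtain ⟨δ, hδ0, hδ⟩ := ENNReal.lt_iff_exists_nnreal_btwn.mp hε
    have hδ0 : 0 < δ := by exact_mod_cast hδ0
    refine ⟨Set.Icc 0 ((C + 1) / δ), isCompact_Icc, ?_⟩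
    rintro _ ⟨_, ⟨n, rfl⟩, rfl⟩
    refine le_trans ?_ hδ.le
    have hR : 0 < (C + 1) / δ := by positivity
    calc (ν n : Measure NNReal) (Set.Icc 0 ((C + 1) / δ))ᶜ
        ≤ (ν n : Measure NNReal) {x : NNReal | (((C + 1) / δ : NNReal) : ENNReal) ≤
            ((x ^ (1 : ℝ) : NNReal) : ENNReal)} := measure_mono fun x hx => by
          simp only [Set.mem_compl_iff, Set.mem_Icc, zero_le, true_and, not_le] at hx
          simpa only [Set.mem_ofPred_eq, NNReal.rpow_one, ENNReal.coe_le_coe] using hx.le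
      _ ≤ φ n 1 / (((C + 1) / δ : NNReal) : ENNReal) := by
          rw [← hν n 1 one_pos]
          exact meas_ge_le_lintegral_div (by fun_prop) (by exact_mod_cast hR.ne')
            ENNReal.coe_ne_top
      _ ≤ C / (((C + 1) / δ : NNReal) : ENNReal) := by gcongr; exact hC n
      _ ≤ δ := by
          rw [← ENNReal.coe_div hR.ne', ENNReal.coe_le_coe, div_div_eq_mul_div]
          rw [div_le_iff₀ (by positivity), mul_comm]
          gcongr
          exact le_self_add
  obtain ⟨κ, -, hκ⟩ := (isCompact_closure_of_isTightMeasureSet htight).ultrafilter_le_nhds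
    ((hyperfilter ℕ).map ν) (le_principal_iff.mpr (mem_map.mpr (univ_mem' fun n =>
      subset_closure (Set.mem_range_self n))))
  have hκ : Tendsto ν (hyperfilter ℕ) (𝓝 κ) := hκ
  rw [ProbabilityMeasure.tendsto_iff_forall_lintegral_tendsto] at hκ
  refine ⟨κ, fun t ht => ?_⟩
  have hlim' : ∀ t, 0 < t → Tendsto (fun n => φ n t) (hyperfilter ℕ) (𝓝 (ψ t)) := fun t ht =>
    (hlim t ht).mono_left Nat.hyperfilter_le_atTop
  have htrunc : ∀ R : ℕ, Tendsto (fun n => ∫⁻ x, ((min (x ^ t) R : NNReal) : ENNReal)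
      ∂(ν n : Measure NNReal)) (hyperfilter ℕ)
      (𝓝 (∫⁻ x, ((min (x ^ t) R : NNReal) : ENNReal) ∂(κ : Measure NNReal))) := fun R =>
    hκ (BoundedContinuousFunction.mkOfBound ⟨fun x : NNReal => min (x ^ t) R,
      (NNReal.continuous_rpow_const ht.le).min continuous_const⟩ R fun x y => by
        rw [NNReal.dist_eq]
        refine abs_sub_le_of_nonneg_of_le (NNReal.coe_nonneg _) ?_ (NNReal.coe_nonneg _) ?_ <;>
        exact_mod_cast min_le_right _ _)
  apply le_antisymm
  · have hsup : ∀ x : NNReal, ((x ^ t : NNReal) : ENNReal) =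
        ⨆ R : ℕ, ((min (x ^ t) R : NNReal) : ENNReal) := fun x => by
      refine le_antisymm ?_ (iSup_le fun R => ENNReal.coe_le_coe.mpr (min_le_left _ _))
      obtain ⟨R, hR⟩ := exists_nat_ge (x ^ t)
      exact le_iSup_of_le R (by rw [min_eq_left hR])
    simp only [hsup]
    rw [lintegral_iSup (fun R => by fun_prop) (fun R S hRS x => by
      show ((_ : NNReal) : ENNReal) ≤ ((_ : NNReal) : ENNReal)
      rw [ENNReal.coe_le_coe]
      exact min_le_min_left _ (by exact_mod_cast hRS))]
    refine iSup_le fun R => le_of_tendsto_of_tendsto' (htrunc R) (hlim' t ht) fun n => ?_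
    rw [← hν n t ht]
    exact lintegral_mono fun x => ENNReal.coe_le_coe.mpr (min_le_left _ _)
  · have hle : ∀ R : ℕ, 0 < R → ψ t ≤ ∫⁻ x, ((x ^ t : NNReal) : ENNReal) ∂(κ : Measure NNReal) +
        (R : ENNReal)⁻¹ * ψ (t * 2) := fun R hR => by
      have hRt : (R : ENNReal)⁻¹ ≠ ⊤ := by simpa using hR.ne'
      have h2 := (htrunc R).add (ENNReal.Tendsto.const_mul (hlim' (t * 2) (by positivity))
        (Or.inr hRt))
      refine (le_of_tendsto_of_tendsto' (hlim' t ht) h2 fun n => ?_).trans ?_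
      · rw [← hν n t ht, ← hν n (t * 2) (by positivity), ← lintegral_const_mul _ (by fun_prop),
          ← lintegral_add_left (by fun_prop)]
        refine lintegral_mono fun x => ?_
        have : x ^ t ≤ min (x ^ t) R + (R : NNReal)⁻¹ * x ^ (t * 2) := by
          rcases le_total (x ^ t) R with h | h
          · rw [min_eq_left h]; exact le_self_add
          · refine le_add_left ?_
            have hR' : (0 : NNReal) < R := by exact_mod_cast hR
            rw [NNReal.rpow_mul, NNReal.rpow_two, inv_mul_eq_div, le_div_iff₀ hR', sq]
            gcongr
        have hR' : (R : NNReal) ≠ 0 := by exact_mod_cast hR.ne'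
        have := ENNReal.coe_le_coe.mpr this
        rwa [ENNReal.coe_add, ENNReal.coe_mul, ENNReal.coe_inv hR', ENNReal.coe_natCast] at this
      · gcongr
        exact min_le_left _ _
    have hl : Tendsto (fun R : ℕ => ∫⁻ x, ((x ^ t : NNReal) : ENNReal) ∂(κ : Measure NNReal) +
        (R : ENNReal)⁻¹ * ψ (t * 2)) atTop
        (𝓝 (∫⁻ x, ((x ^ t : NNReal) : ENNReal) ∂(κ : Measure NNReal) + 0 * ψ (t * 2))) :=
      tendsto_const_nhds.add (ENNReal.Tendsto.mul_const ENNReal.tendsto_inv_nat_nhds_zero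
        (Or.inr (hψ _ (by positivity))))
    rw [zero_mul, add_zero] at hl
    exact ge_of_tendsto hl ((eventually_gt_atTop 0).mono hle)

open Filter Topology in
theorem hasMoments_Gamma_div_Gamma {α : ℝ} (h0 : 0 < α) (h1 : α ≤ 1) :
    HasMoments fun t => ENNReal.ofReal (Gamma t / (α * Gamma (α * t))) := by
  have hprod : ∀ n : ℕ, HasMoments fun t => ∏ j ∈ Finset.range n,
      ENNReal.ofReal ((((j + 1 : ℕ) : ℝ) + α * t) / (((j + 1 : ℕ) : ℝ) + t)) := by
    intro n
    induction n with
    | zero => simpa using hasMoments_const_rpow 1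
    | succ n ih =>
      simp only [Finset.prod_range_succ]
      exact ih.mul (hasMoments_add_mul_div_add h0.le h1 (by positivity))
  refine HasMoments.of_tendsto
    (fun n => (hasMoments_const_rpow ((n : NNReal) ^ (1 - α))).mul (hprod n))
    (fun n => ENNReal.mul_ne_top ENNReal.coe_ne_top (ENNReal.prod_ne_top fun _ _ =>
      ENNReal.ofReal_ne_top)) (fun _ _ => ENNReal.ofReal_ne_top) fun t ht => ?_
  have hαt : 0 < α * t := by positivity
  have hlim := ENNReal.tendsto_ofReal ((GammaSeq_tendsto_Gamma t).div
    ((GammaSeq_tendsto_Gamma (α * t)).const_mul α)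
    (mul_pos h0 (Gamma_pos_of_pos hαt)).ne')
  refine hlim.congr' ((eventually_gt_atTop 0).mono fun n hn => ?_)
  have hn0 : (0 : ℝ) < n := by exact_mod_cast hn
  have e : (((((n : NNReal) ^ (1 - α)) ^ t : NNReal)) : ENNReal) =
      ENNReal.ofReal (((n : ℝ) ^ (1 - α)) ^ t) := by
    rw [ENNReal.ofReal, ENNReal.coe_inj, ← NNReal.coe_inj, Real.coe_toNNReal _ (by positivity)]
    simp
  beta_reduce
  rw [e, ← ENNReal.ofReal_prod_of_nonneg fun _ _ => by positivity,
    ← ENNReal.ofReal_mul (by positivity)]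
  congr 1
  have hp1 : 0 < ∏ j ∈ Finset.range n, (t + ((j + 1 : ℕ) : ℝ)) :=
    Finset.prod_pos fun _ _ => by positivity
  have hp2 : 0 < ∏ j ∈ Finset.range n, (α * t + ((j + 1 : ℕ) : ℝ)) :=
    Finset.prod_pos fun _ _ => by positivity
  simp only [Pi.div_apply, GammaSeq, Finset.prod_range_succ', Finset.prod_div_distrib,
    add_comm _ t, add_comm _ (α * t)]
  rw [← rpow_mul hn0.le, show (1 - α) * t = t - α * t by ring, rpow_sub hn0]
  have := rpow_pos_of_pos hn0 (α * t)
  field_simp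
  simp

theorem isXLaw_of_lintegral_rpow {a b c d : ℝ} (ha : 0 < a) (hb : 0 < b) (hc : 0 < c)
    {μ : Measure ℝ} (h0 : μ (Set.Ioi (0 : ℝ))ᶜ = 0)
    (h : ∀ s ∈ Set.Ioo (-a) b, ∫⁻ x, ENNReal.ofReal (x ^ s) ∂μ =
      ENNReal.ofReal (Real.Gamma c / (Real.Gamma a * Real.Gamma b) *
        (Real.Gamma (a + s) * Real.Gamma (b - s) / Real.Gamma (c + d * s)))) :
    IsXLaw a b c d μ := by
  refine ⟨⟨?_⟩, h0, h⟩
  have hΓa := Gamma_pos_of_pos ha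
  have hΓb := Gamma_pos_of_pos hb
  have hΓc := Gamma_pos_of_pos hc
  have := h 0 ⟨by linarith, hb⟩
  simp only [rpow_zero, ENNReal.ofReal_one, lintegral_one, add_zero, sub_zero, mul_zero] at this
  rw [this, show Gamma c / (Gamma a * Gamma b) * (Gamma a * Gamma b / Gamma c) = 1 by field_simp,
    ENNReal.ofReal_one]

theorem XExists_of_le_of_two_mul_le {a b c d : ℝ} (ha : 0 < a) (hb : 0 < b) (hc : 0 < c)
    (hd : 0 < d) (hd2 : d ≤ 2) (h1 : 3 * a + b ≤ 2 * c / d)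
    (h2 : a + b ≤ 2 * (c / d - a) * (c / d + 1 / 2 - a)) : XExists a b c d := by
  have hcd : 2 * c / d = 2 * (c / d) := mul_div_assoc _ _ _
  obtain ⟨ρ, _, hρ, hL⟩ := exists_laplace (A := a + b) (μ := 2 * c / d - 2 * a) (by positivity)
    (by linarith) (by rw [hcd]; linarith)
  obtain ⟨ν, hν⟩ := hasMoments_Gamma_div_Gamma (α := d / 2) (by positivity) (by linarith)
  set σ := 2 * c / d with hσ
  have hσ0 : 0 < σ := by positivity
  have hΓa := Gamma_pos_of_pos ha
  have hΓb := Gamma_pos_of_pos hb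
  have hΓc := Gamma_pos_of_pos hc
  have hΓA := Gamma_pos_of_pos (add_pos ha hb)
  have hg : Measurable fun p : ℝ × NNReal => ENNReal.ofReal (p.1 ^ (-σ)) *
      ((p.2 ^ σ : NNReal) : ENNReal) := by fun_prop
  have hf : Measurable fun p : ℝ × NNReal => ((p.2 : ℝ) / p.1) ^ 2 := by fun_prop
  refine ⟨ENNReal.ofReal (Gamma c / (Gamma a * Gamma b) * (Gamma (a + b) * d)) •
    ((ρ.prod (ν : Measure NNReal)).withDensity fun p => ENNReal.ofReal (p.1 ^ (-σ)) *
      ((p.2 ^ σ : NNReal) : ENNReal)).map fun p => ((p.2 : ℝ) / p.1) ^ 2,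
    isXLaw_of_lintegral_rpow ha hb hc ?_ fun s hs => ?_⟩
  · rw [Measure.smul_apply, Measure.map_apply hf measurableSet_Ioi.compl,
      withDensity_apply _ (hf measurableSet_Ioi.compl),
      setLIntegral_congr_fun (g := fun _ => 0) (hf measurableSet_Ioi.compl) fun p hp => ?_]
    · simp
    · have hp : ¬ 0 < ((p.2 : ℝ) / p.1) ^ 2 := hp
      have : ((p.2 : ℝ) / p.1) = 0 := by
        by_contra hne
        exact hp (by positivity)
      rcases div_eq_zero_iff.mp this with h | h
      · have h : p.2 = 0 := by exact_mod_cast h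
        simp [h, NNReal.zero_rpow hσ0.ne']
      · simp [h, zero_rpow (neg_ne_zero.mpr hσ0.ne')]
  · obtain ⟨hs1, hs2⟩ := hs
    have hq : 0 < a + s := by linarith
    have hbs : 0 < b - s := by linarith
    have hσs : 0 < σ + 2 * s := by linarith
    have hcs : d / 2 * (σ + 2 * s) = c + d * s := by rw [hσ]; field_simp
    have hcs0 : 0 < c + d * s := by rw [← hcs]; positivity
    have hM := lintegral_rpow_neg_of_laplace (by linarith) hq (by linarith) hρ hL
    rw [show σ - 2 * a + 2 * (a + s) = σ + 2 * s by ring,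
      show a + b - (a + s) = b - s by ring] at hM
    have hN := hν (σ + 2 * s) hσs
    beta_reduce at hN
    rw [hcs] at hN
    have hΓ1 := Gamma_pos_of_pos hq
    have hΓ2 := Gamma_pos_of_pos hbs
    have hΓ3 := Gamma_pos_of_pos hσs
    have hΓ4 := Gamma_pos_of_pos hcs0
    rw [lintegral_smul_measure, lintegral_map (by fun_prop) hf,
      lintegral_withDensity_eq_lintegral_mul _ hg (by fun_prop)]
    have e : ∫⁻ p : ℝ × NNReal, ((fun p : ℝ × NNReal => ENNReal.ofReal (p.1 ^ (-σ)) *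
        ((p.2 ^ σ : NNReal) : ENNReal)) * fun p : ℝ × NNReal => ENNReal.ofReal ((((p.2 : ℝ) / p.1) ^ 2) ^ s)) p
          ∂(ρ.prod (ν : Measure NNReal)) =
        ∫⁻ p : ℝ × NNReal, ENNReal.ofReal (p.1 ^ (-(σ + 2 * s))) *
          ((p.2 ^ (σ + 2 * s) : NNReal) : ENNReal) ∂(ρ.prod (ν : Measure NNReal)) := by
      have hae : ∀ᵐ t ∂ρ, t ∈ Set.Ioi (0 : ℝ) := by rwa [ae_iff]
      refine lintegral_congr_ae ?_
      filter_upwards [Measure.quasiMeasurePreserving_fst.ae hae] with ⟨t, x⟩ ht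
      have ht : 0 < t := ht
      simp only [Pi.mul_apply]
      rcases eq_or_ne x 0 with rfl | hx
      · simp [NNReal.zero_rpow hσ0.ne', NNReal.zero_rpow hσs.ne']
      have hx : 0 < (x : ℝ) := NNReal.coe_pos.mpr (pos_iff_ne_zero.mpr hx)
      rw [← ENNReal.ofReal_coe_nnreal, ← ENNReal.ofReal_coe_nnreal, NNReal.coe_rpow,
        NNReal.coe_rpow, ← ENNReal.ofReal_mul (by positivity), ← ENNReal.ofReal_mul (by positivity),
        ← ENNReal.ofReal_mul (by positivity), ← rpow_natCast, ← rpow_mul (by positivity),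
        div_rpow hx.le ht.le, neg_add, rpow_add ht, rpow_add hx, rpow_neg ht.le (2 * s)]
      congr 1
      push_cast
      field_simp
    rw [e, lintegral_prod_mul (f := fun t : ℝ => ENNReal.ofReal (t ^ (-(σ + 2 * s))))
      (g := fun x : NNReal => ((x ^ (σ + 2 * s) : NNReal) : ENNReal)) (by fun_prop) (by fun_prop),
      hM, hN, smul_eq_mul, ← ENNReal.ofReal_mul (by positivity), ← ENNReal.ofReal_mul (by positivity)]
    congr 1
    generalize Gamma (σ + 2 * s) = G at hΓ3 ⊢
    field_simp

theorem XExists_of_one_lt_d_lt_two (a b c d : ℝ) (ha : 0 < a) (hb : 0 < b) (hc : 0 < c)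
    (hd1 : 1 < d) (hd2 : d < 2) :
    (3 * a + b ≤ 2 * c / d → a + b ≤ 2 * (c / d - a) * (c / d + 1 / 2 - a) →
      XExists a b c d) ∧
    (1 ≤ a + b → 3 * a + b ≤ 2 * c / d → XExists a b c d) := by
  have hd : 0 < d := one_pos.trans hd1
  refine ⟨XExists_of_le_of_two_mul_le ha hb hc hd hd2.le, fun hab h1 =>
    XExists_of_le_of_two_mul_le ha hb hc hd hd2.le h1 ?_⟩
  have h2 : a + b ≤ 2 * (c / d - a) := by
    rw [mul_div_assoc] at h1
    linarith
  nlinarith
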